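/- arXiv:1504.01115 — 2 statements merged into one kernel-verified Lean document; each statement's English description precedes it below -/
import Mathlib

section
/- For Schwartz functions f, h on ℝ⁴ and an invertible real antisymmetric 4×4 matrix θ, the Moyal product (f ⋆ h)(x) = ∫∫ e^{2πi p·z} f(x − θp) h(x − z) d⁴p d⁴z defines a Schwartz function, and the product is associative: (f ⋆ g) ⋆ h = f ⋆ (g ⋆ h) for all f, g, h ∈ 𝒮(ℝ⁴). -/
open MeasureTheory

/-- The Moyal product
`(f ⋆ h)(x) = ∫∫ e^{2πi p·z} f(x − θp) h(x − z) d⁴p d⁴z` on functions on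
`ℝ⁴`, for a real `4×4` matrix `θ`. -/
noncomputable def moyal (θ : Matrix (Fin 4) (Fin 4) ℝ)
    (f h : (Fin 4 → ℝ) → ℂ) : (Fin 4 → ℝ) → ℂ :=
  fun x => ∫ p : Fin 4 → ℝ, ∫ z : Fin 4 → ℝ,
    Complex.exp (2 * (Real.pi : ℂ) * Complex.I * ((∑ μ, p μ * z μ : ℝ) : ℂ)) *
      f (x - θ.mulVec p) * h (x - z)

open scoped FourierTransform SchwartzMap ContDiff

namespace SchwartzMap

variable {V W E : Type} [NormedAddCommGroup V] [NormedSpace ℝ V]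
  [NormedAddCommGroup W] [NormedSpace ℝ W] [NormedAddCommGroup E] [NormedSpace ℝ E]

/-- The external product `(x, y) ↦ f x * h y` of two Schwartz functions. -/
noncomputable def tensorMul (f : 𝓢(V, ℂ)) (h : 𝓢(W, ℂ)) : 𝓢(V × W, ℂ) where
  toFun z := f z.1 * h z.2
  smooth' := ((f.smooth ⊤).comp contDiff_fst).mul ((h.smooth ⊤).comp contDiff_snd)
  decay' k n := by
    have hf : ContDiff ℝ ∞ (fun z : V × W ↦ f z.1) := (f.smooth ⊤).comp contDiff_fst
    have hh : ContDiff ℝ ∞ (fun z : V × W ↦ h z.2) := (h.smooth ⊤).comp contDiff_snd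
    have hf' (i : ℕ) (z : V × W) :
        ‖iteratedFDeriv ℝ i (fun z : V × W ↦ f z.1) z‖ ≤ ‖iteratedFDeriv ℝ i f z.1‖ := by
      have := (ContinuousLinearMap.fst ℝ V W).iteratedFDeriv_comp_right (f.smooth ⊤) z
        (i := i) (mod_cast le_top)
      change ‖iteratedFDeriv ℝ i (f ∘ ContinuousLinearMap.fst ℝ V W) z‖ ≤ _
      rw [this]
      refine (ContinuousMultilinearMap.norm_compContinuousLinearMap_le _ _).trans ?_
      refine mul_le_of_le_one_right (norm_nonneg _) ?_
      exact Finset.prod_le_one (fun _ _ ↦ norm_nonneg _)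
        (fun _ _ ↦ ContinuousLinearMap.norm_fst_le ..)
    have hh' (i : ℕ) (z : V × W) :
        ‖iteratedFDeriv ℝ i (fun z : V × W ↦ h z.2) z‖ ≤ ‖iteratedFDeriv ℝ i h z.2‖ := by
      have := (ContinuousLinearMap.snd ℝ V W).iteratedFDeriv_comp_right (h.smooth ⊤) z
        (i := i) (mod_cast le_top)
      change ‖iteratedFDeriv ℝ i (h ∘ ContinuousLinearMap.snd ℝ V W) z‖ ≤ _
      rw [this]
      refine (ContinuousMultilinearMap.norm_compContinuousLinearMap_le _ _).trans ?_
      refine mul_le_of_le_one_right (norm_nonneg _) ?_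
      exact Finset.prod_le_one (fun _ _ ↦ norm_nonneg _)
        (fun _ _ ↦ ContinuousLinearMap.norm_snd_le ..)
    refine ⟨∑ i ∈ Finset.range (n + 1), (n.choose i : ℝ) *
      (SchwartzMap.seminorm ℝ k i f * SchwartzMap.seminorm ℝ 0 (n - i) h +
        SchwartzMap.seminorm ℝ 0 i f * SchwartzMap.seminorm ℝ k (n - i) h), fun z ↦ ?_⟩
    refine (mul_le_mul_of_nonneg_left (norm_iteratedFDeriv_mul_le hf hh z
      (n := n) (mod_cast le_top)) (by positivity)).trans ?_
    rw [Finset.mul_sum]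
    refine Finset.sum_le_sum fun i _ ↦ ?_
    have hz : ‖z‖ ^ k ≤ ‖z.1‖ ^ k + ‖z.2‖ ^ k := by
      rw [Prod.norm_def]
      rcases max_cases ‖z.1‖ ‖z.2‖ with ⟨h, _⟩ | ⟨h, _⟩ <;> rw [h] <;> simp
    calc ‖z‖ ^ k * (n.choose i * ‖iteratedFDeriv ℝ i (fun z : V × W ↦ f z.1) z‖ *
          ‖iteratedFDeriv ℝ (n - i) (fun z : V × W ↦ h z.2) z‖)
        ≤ (‖z.1‖ ^ k + ‖z.2‖ ^ k) * (n.choose i * ‖iteratedFDeriv ℝ i f z.1‖ *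
          ‖iteratedFDeriv ℝ (n - i) h z.2‖) := by
          gcongr
          exacts [hf' i z, hh' (n - i) z]
      _ = n.choose i * ((‖z.1‖ ^ k * ‖iteratedFDeriv ℝ i f z.1‖) *
            ‖iteratedFDeriv ℝ (n - i) h z.2‖ + ‖iteratedFDeriv ℝ i f z.1‖ *
            (‖z.2‖ ^ k * ‖iteratedFDeriv ℝ (n - i) h z.2‖)) := by ring
      _ ≤ _ := by
          gcongr
          exacts [le_seminorm ℝ k i f z.1, norm_iteratedFDeriv_le_seminorm ℝ h _ _,
            norm_iteratedFDeriv_le_seminorm ℝ f _ _, le_seminorm ℝ k _ h z.2]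

variable [MeasurableSpace W] (μ : Measure W)

theorem norm_pow_mul_norm_le_integrable (G : 𝓢(V × W, E)) (k : ℕ) :
    ∃ C, ∀ (x : V) (y : W),
      ‖x‖ ^ k * ‖G (x, y)‖ ≤ C * (1 + ‖y‖) ^ (-(μ.integrablePower : ℝ)) := by
  set l := μ.integrablePower
  refine ⟨2 ^ l * (SchwartzMap.seminorm ℝ k 0 G + SchwartzMap.seminorm ℝ (k + l) 0 G),
    fun x y ↦ ?_⟩
  have hx : ‖x‖ ≤ ‖(x, y)‖ := by simp [Prod.norm_def]
  have hy : ‖y‖ ≤ ‖(x, y)‖ := by simp [Prod.norm_def]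
  have := pow_mul_le_of_le_of_pow_mul_le (k := 0) (l := l) (norm_nonneg y)
    (f := ‖x‖ ^ k * ‖G (x, y)‖) (by positivity)
    (C₁ := SchwartzMap.seminorm ℝ k 0 G) (C₂ := SchwartzMap.seminorm ℝ (k + l) 0 G) ?_ ?_
  · simpa using this
  · refine le_trans ?_ (norm_pow_mul_le_seminorm ℝ G k (x, y))
    gcongr
  · refine le_trans ?_ (norm_pow_mul_le_seminorm ℝ G (k + l) (x, y))
    rw [zero_add, ← mul_assoc, pow_add, mul_comm (‖(x, y)‖ ^ k)]
    gcongr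

variable [BorelSpace W] [SecondCountableTopology W] [μ.HasTemperateGrowth]

theorem integrable_prodMk_left (G : 𝓢(V × W, E)) (x : V) : Integrable (fun y ↦ G (x, y)) μ := by
  obtain ⟨C, hC⟩ := G.norm_pow_mul_norm_le_integrable μ 0
  refine ((Measure.integrable_pow_neg_integrablePower μ).const_mul C).mono' ?_
    (.of_forall fun y ↦ by simpa using hC x y)
  exact (G.continuous.comp (by fun_prop)).aestronglyMeasurable

/-- The partial derivative of a Schwartz function on a product along the first factor. -/
noncomputable def fderivFst (G : 𝓢(V × W, E)) : 𝓢(V × W, V →L[ℝ] E) :=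
  postcompCLM ((ContinuousLinearMap.compL ℝ V (V × W) E).flip (ContinuousLinearMap.inl ℝ V W))
    (fderivCLM ℝ (V × W) E G)

theorem hasFDerivAt_integral_snd (G : 𝓢(V × W, E)) (x : V) :
    HasFDerivAt (fun x ↦ ∫ y, G (x, y) ∂μ) (∫ y, G.fderivFst (x, y) ∂μ) x := by
  obtain ⟨C, hC⟩ := G.fderivFst.norm_pow_mul_norm_le_integrable μ 0
  refine hasFDerivAt_integral_of_dominated_of_fderiv_le (F' := fun x y ↦ G.fderivFst (x, y))
    (bound := fun y ↦ C * (1 + ‖y‖) ^ (-(μ.integrablePower : ℝ))) Filter.univ_mem ?_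
    (G.integrable_prodMk_left μ x) (G.fderivFst.integrable_prodMk_left μ x).1 ?_ ?_ ?_
  · exact .of_forall fun x ↦ (G.integrable_prodMk_left μ x).1
  · exact .of_forall fun y x _ ↦ by simpa using hC x y
  · exact (Measure.integrable_pow_neg_integrablePower μ).const_mul C
  · exact .of_forall fun y x _ ↦ (G.hasFDerivAt (x, y)).comp x (hasFDerivAt_prodMk_left x y)

theorem contDiff_integral_snd (n : ℕ) : ∀ {E : Type} [NormedAddCommGroup E] [NormedSpace ℝ E]
    (G : 𝓢(V × W, E)), ContDiff ℝ n (fun x ↦ ∫ y, G (x, y) ∂μ) := by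
  induction n with
  | zero =>
    intro E _ _ G
    exact contDiff_zero.2 (continuous_iff_continuousAt.2 fun x ↦
      (G.hasFDerivAt_integral_snd μ x).continuousAt)
  | succ n ih =>
    intro E _ _ G
    exact contDiff_succ_iff_hasFDerivAt.2 ⟨_, ih G.fderivFst, G.hasFDerivAt_integral_snd μ⟩

theorem decay_integral_snd (k n : ℕ) : ∀ {E : Type} [NormedAddCommGroup E] [NormedSpace ℝ E]
    (G : 𝓢(V × W, E)), ∃ C, ∀ x,
      ‖x‖ ^ k * ‖iteratedFDeriv ℝ n (fun x ↦ ∫ y, G (x, y) ∂μ) x‖ ≤ C := by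
  induction n with
  | zero =>
    intro E _ _ G
    obtain ⟨C, hC⟩ := G.norm_pow_mul_norm_le_integrable μ k
    refine ⟨∫ y, C * (1 + ‖y‖) ^ (-(μ.integrablePower : ℝ)) ∂μ, fun x ↦ ?_⟩
    rw [norm_iteratedFDeriv_zero]
    calc ‖x‖ ^ k * ‖∫ y, G (x, y) ∂μ‖ ≤ ‖x‖ ^ k * ∫ y, ‖G (x, y)‖ ∂μ := by
          gcongr
          exact norm_integral_le_integral_norm _
      _ = ∫ y, ‖x‖ ^ k * ‖G (x, y)‖ ∂μ := (integral_const_mul _ _).symm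
      _ ≤ _ := integral_mono ((G.integrable_prodMk_left μ x).norm.const_mul _)
          ((Measure.integrable_pow_neg_integrablePower μ).const_mul C) (hC x)
  | succ n ih =>
    intro E _ _ G
    obtain ⟨C, hC⟩ := ih G.fderivFst
    refine ⟨C, fun x ↦ ?_⟩
    rw [← norm_iteratedFDeriv_fderiv,
      show fderiv ℝ (fun x ↦ ∫ y, G (x, y) ∂μ) = fun x ↦ ∫ y, G.fderivFst (x, y) ∂μ from
        funext fun x ↦ (G.hasFDerivAt_integral_snd μ x).fderiv]
    exact hC x

/-- Integrating out the second variable of a Schwartz function on a product. -/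
noncomputable def integralSnd (G : 𝓢(V × W, E)) : 𝓢(V, E) where
  toFun x := ∫ y, G (x, y) ∂μ
  smooth' := contDiff_infty.2 fun n ↦ G.contDiff_integral_snd μ n
  decay' k n := G.decay_integral_snd μ k n

end SchwartzMap

/-- The additive character `t ↦ e^{2πit}` of the real line. -/
noncomputable def realPhase (t : ℝ) : ℂ :=
  Complex.exp (2 * (Real.pi : ℂ) * Complex.I * (t : ℂ))

theorem realPhase_add (s t : ℝ) : realPhase (s + t) = realPhase s * realPhase t := by
  simp only [realPhase, ← Complex.exp_add]
  push_cast
  ring_nf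

theorem hasDerivAt_realPhase (t : ℝ) :
    HasDerivAt realPhase ((2 * (Real.pi : ℂ) * Complex.I) * realPhase t) t := by
  have h : HasDerivAt (fun t : ℝ ↦ 2 * (Real.pi : ℂ) * Complex.I * (t : ℂ))
      (2 * (Real.pi : ℂ) * Complex.I) t := by
    simpa using (Complex.ofRealCLM.hasDerivAt (x := t)).const_mul (2 * (Real.pi : ℂ) * Complex.I)
  rw [mul_comm]
  exact h.cexp

theorem norm_realPhase (t : ℝ) : ‖realPhase t‖ = 1 := by
  rw [realPhase, Complex.norm_exp]
  simp

theorem iteratedDeriv_realPhase (n : ℕ) :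
    iteratedDeriv n realPhase = fun t ↦ (2 * (Real.pi : ℂ) * Complex.I) ^ n * realPhase t := by
  induction n with
  | zero => simp
  | succ n ih =>
    rw [iteratedDeriv_succ, ih]
    ext t
    rw [((hasDerivAt_realPhase t).const_mul _).deriv]
    ring

@[fun_prop]
theorem hasTemperateGrowth_realPhase : realPhase.HasTemperateGrowth := by
  refine ⟨?_, fun n ↦ ⟨0, (2 * Real.pi) ^ n, fun t ↦ ?_⟩⟩
  · have : ContDiff ℝ ∞ fun t : ℝ ↦ (t : ℂ) := Complex.ofRealCLM.contDiff
    exact (contDiff_const.mul this).cexp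
  · rw [norm_iteratedFDeriv_eq_norm_iteratedDeriv, iteratedDeriv_realPhase]
    simp [norm_realPhase, abs_of_pos Real.pi_pos]

section Fourier

variable {ι : Type} [Fintype ι]

theorem hasTemperateGrowth_realPhase_dotProduct :
    Function.HasTemperateGrowth
      (fun z : (ι → ℝ) × (ι → ℝ) ↦ realPhase (z.2 ⬝ᵥ z.1)) := by
  have h (i : ι) : Function.HasTemperateGrowth
      (fun z : (ι → ℝ) × (ι → ℝ) ↦ z.2 i * z.1 i) :=
    Function.HasTemperateGrowth.fun_mul
      ((ContinuousLinearMap.proj (R := ℝ) (φ := fun _ : ι ↦ ℝ) i).comp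
        (ContinuousLinearMap.snd ℝ (ι → ℝ) (ι → ℝ))).hasTemperateGrowth
      ((ContinuousLinearMap.proj (R := ℝ) (φ := fun _ : ι ↦ ℝ) i).comp
        (ContinuousLinearMap.fst ℝ (ι → ℝ) (ι → ℝ))).hasTemperateGrowth
  exact hasTemperateGrowth_realPhase.comp (.sum fun i _ ↦ h i)

namespace SchwartzMap

/-- The Fourier transform of a Schwartz function on `ι → ℝ`, for the pairing `p ⬝ᵥ x`. -/
noncomputable def piFourier (f : 𝓢(ι → ℝ, ℂ)) : 𝓢(ι → ℝ, ℂ) :=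
  compCLMOfContinuousLinearEquiv ℂ (EuclideanSpace.equiv ι ℝ).symm
    (𝓕 (compCLMOfContinuousLinearEquiv ℂ (EuclideanSpace.equiv ι ℝ) f))

theorem piFourier_apply (f : 𝓢(ι → ℝ, ℂ)) (p : ι → ℝ) :
    f.piFourier p = ∫ x, realPhase (-(p ⬝ᵥ x)) * f x := by
  rw [← (EuclideanSpace.volume_preserving_symm_measurableEquiv_toLp ι).integral_comp']
  simp only [piFourier, compCLMOfContinuousLinearEquiv_apply, Function.comp_apply, fourier_coe,
    Real.fourier_eq', smul_eq_mul]
  refine integral_congr_ae (.of_forall fun x ↦ ?_)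
  have hx : inner ℝ x ((EuclideanSpace.equiv ι ℝ).symm p) = p ⬝ᵥ (MeasurableEquiv.toLp 2 (ι → ℝ)).symm x := by
    simp [PiLp.inner_apply, dotProduct]
  simp only [hx, realPhase]
  congr 2
  push_cast
  ring

theorem integral_realPhase_mul_comp_sub_left (f : 𝓢(ι → ℝ, ℂ)) (p x : ι → ℝ) :
    ∫ z, realPhase (p ⬝ᵥ z) * f (x - z) = realPhase (p ⬝ᵥ x) * f.piFourier p := by
  rw [piFourier_apply, ← integral_const_mul,
    ← integral_sub_left_eq_self (fun z ↦ realPhase (p ⬝ᵥ x) * (realPhase (-(p ⬝ᵥ z)) * f z)) _ x]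
  refine integral_congr_ae (.of_forall fun z ↦ ?_)
  simp only [← mul_assoc, ← realPhase_add, dotProduct_sub]
  ring_nf

theorem integrable_volume_prod (G : 𝓢((ι → ℝ) × (ι → ℝ), ℂ)) :
    Integrable G (volume.prod volume) := by
  have : ((volume : Measure (ι → ℝ)).prod (volume : Measure (ι → ℝ))).IsAddHaarMeasure :=
    Measure.prod.instIsAddHaarMeasure _ _
  exact G.integrable

end SchwartzMap

end Fourier

/-- The shear `(x, p) ↦ (x - θ p, p)`. -/
noncomputable def moyalShear (θ : Matrix (Fin 4) (Fin 4) ℝ) :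
    ((Fin 4 → ℝ) × (Fin 4 → ℝ)) ≃L[ℝ] ((Fin 4 → ℝ) × (Fin 4 → ℝ)) :=
  LinearEquiv.toContinuousLinearEquiv
    { toFun z := (z.1 - θ.mulVec z.2, z.2)
      invFun z := (z.1 + θ.mulVec z.2, z.2)
      map_add' z w := by
        ext1
        · simp [Matrix.mulVec_add, add_sub_add_comm]
        · simp
      map_smul' c z := by simp [Matrix.mulVec_smul, smul_sub]
      left_inv z := by simp
      right_inv z := by simp }

/-- The Schwartz function `(x, p) ↦ e^{2πi p·x} f(x − θp) ĥ(p)`, whose integral over `p` is the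
Moyal product of `f` and `h`. -/
noncomputable def moyalKernel (θ : Matrix (Fin 4) (Fin 4) ℝ) (f h : 𝓢(Fin 4 → ℝ, ℂ)) :
    𝓢((Fin 4 → ℝ) × (Fin 4 → ℝ), ℂ) :=
  SchwartzMap.smulLeftCLM ℂ (fun z : (Fin 4 → ℝ) × (Fin 4 → ℝ) ↦ realPhase (z.2 ⬝ᵥ z.1))
    (SchwartzMap.compCLMOfContinuousLinearEquiv ℂ (moyalShear θ) (f.tensorMul h.piFourier))

theorem moyalKernel_apply (θ : Matrix (Fin 4) (Fin 4) ℝ) (f h : 𝓢(Fin 4 → ℝ, ℂ))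
    (x p : Fin 4 → ℝ) :
    moyalKernel θ f h (x, p) =
      realPhase (p ⬝ᵥ x) * (f (x - θ.mulVec p) * h.piFourier p) :=
  SchwartzMap.smulLeftCLM_apply_apply hasTemperateGrowth_realPhase_dotProduct _ _

/-- The Moyal product of two Schwartz functions, as a Schwartz function. -/
noncomputable def schwartzMoyal (θ : Matrix (Fin 4) (Fin 4) ℝ) (f h : 𝓢(Fin 4 → ℝ, ℂ)) :
    𝓢(Fin 4 → ℝ, ℂ) :=
  (moyalKernel θ f h).integralSnd volume

theorem schwartzMoyal_apply (θ : Matrix (Fin 4) (Fin 4) ℝ) (f h : 𝓢(Fin 4 → ℝ, ℂ))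
    (x : Fin 4 → ℝ) :
    schwartzMoyal θ f h x =
      ∫ p, realPhase (p ⬝ᵥ x) * (f (x - θ.mulVec p) * h.piFourier p) :=
  integral_congr_ae (.of_forall fun p ↦ moyalKernel_apply θ f h x p)

theorem coe_schwartzMoyal (θ : Matrix (Fin 4) (Fin 4) ℝ) (f h : 𝓢(Fin 4 → ℝ, ℂ)) :
    ⇑(schwartzMoyal θ f h) = moyal θ f h := by
  ext x
  rw [schwartzMoyal_apply, moyal]
  refine integral_congr_ae (.of_forall fun p ↦ ?_)
  calc realPhase (p ⬝ᵥ x) * (f (x - θ.mulVec p) * h.piFourier p)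
      = f (x - θ.mulVec p) * ∫ z, realPhase (p ⬝ᵥ z) * h (x - z) := by
        rw [h.integral_realPhase_mul_comp_sub_left]
        ring
    _ = ∫ z, realPhase (p ⬝ᵥ z) * f (x - θ.mulVec p) * h (x - z) := by
        rw [← integral_const_mul]
        refine integral_congr_ae (.of_forall fun z ↦ ?_)
        simp only
        ring

/-- The Fourier transform of a Moyal product is a twisted convolution. -/
theorem piFourier_schwartzMoyal (θ : Matrix (Fin 4) (Fin 4) ℝ) (g h : 𝓢(Fin 4 → ℝ, ℂ))
    (r : Fin 4 → ℝ) :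
    (schwartzMoyal θ g h).piFourier r =
      ∫ p, realPhase (-((r - p) ⬝ᵥ θ.mulVec p)) * (g.piFourier (r - p) * h.piFourier p) := by
  have key (p : Fin 4 → ℝ) :
      ∫ x, realPhase (-(r ⬝ᵥ x)) * moyalKernel θ g h (x, p) =
        realPhase (-((r - p) ⬝ᵥ θ.mulVec p)) * (g.piFourier (r - p) * h.piFourier p) := by
    rw [← integral_add_right_eq_self _ (θ.mulVec p), g.piFourier_apply, ← integral_mul_const,
      ← integral_const_mul]
    refine integral_congr_ae (.of_forall fun x ↦ ?_)
    simp only [moyalKernel_apply, add_sub_cancel_right]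
    have : realPhase (-(r ⬝ᵥ (x + θ.mulVec p))) * realPhase (p ⬝ᵥ (x + θ.mulVec p)) =
        realPhase (-((r - p) ⬝ᵥ θ.mulVec p)) * realPhase (-((r - p) ⬝ᵥ x)) := by
      simp only [← realPhase_add, sub_dotProduct, dotProduct_add]
      ring_nf
    linear_combination (g x * h.piFourier p) * this
  simp_rw [SchwartzMap.piFourier_apply (schwartzMoyal θ g h), ← key]
  rw [integral_integral_swap]
  · refine integral_congr_ae (.of_forall fun x ↦ ?_)
    simp only
    rw [integral_const_mul]
    rfl
  · have hc : Continuous realPhase := hasTemperateGrowth_realPhase.1.continuous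
    have hm : Continuous fun z : (Fin 4 → ℝ) × (Fin 4 → ℝ) ↦ realPhase (-(r ⬝ᵥ z.2)) := by
      fun_prop
    exact (moyalKernel θ g h).integrable_volume_prod.swap.bdd_mul hm.aestronglyMeasurable
      (.of_forall fun z ↦ (norm_realPhase _).le)

theorem integrable_moyalTriple (θ : Matrix (Fin 4) (Fin 4) ℝ) (f g h : 𝓢(Fin 4 → ℝ, ℂ))
    (x : Fin 4 → ℝ) :
    Integrable (fun z : (Fin 4 → ℝ) × (Fin 4 → ℝ) ↦
      realPhase (z.1 ⬝ᵥ x - (z.1 - z.2) ⬝ᵥ θ.mulVec z.2) * f (x - θ.mulVec z.1) *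
        (g (z.1 - z.2) * h z.2)) (volume.prod volume) := by
  have h_int : Integrable (fun z : (Fin 4 → ℝ) × (Fin 4 → ℝ) ↦ g (z.1 - z.2) * h z.2)
      (volume.prod volume) := by
    have := (SchwartzMap.compCLMOfContinuousLinearEquiv ℂ (moyalShear 1)
      (g.tensorMul h)).integrable_volume_prod
    refine this.congr (.of_forall fun z ↦ ?_)
    change g (z.1 - Matrix.mulVec 1 z.2) * h z.2 = _
    rw [Matrix.one_mulVec]
  have hc : Continuous realPhase := hasTemperateGrowth_realPhase.1.continuous
  have hf : Continuous f := f.continuous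
  have hm : Continuous fun z : (Fin 4 → ℝ) × (Fin 4 → ℝ) ↦
      realPhase (z.1 ⬝ᵥ x - (z.1 - z.2) ⬝ᵥ θ.mulVec z.2) * f (x - θ.mulVec z.1) := by
    fun_prop
  refine h_int.bdd_mul (c := SchwartzMap.seminorm ℝ 0 0 f) hm.aestronglyMeasurable
    (.of_forall fun z ↦ ?_)
  rw [norm_mul, norm_realPhase, one_mul]
  exact f.norm_le_seminorm ℝ _

theorem schwartzMoyal_assoc (θ : Matrix (Fin 4) (Fin 4) ℝ) (f g h : 𝓢(Fin 4 → ℝ, ℂ)) :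
    schwartzMoyal θ (schwartzMoyal θ f g) h = schwartzMoyal θ f (schwartzMoyal θ g h) := by
  ext x
  rw [schwartzMoyal_apply θ _ h, schwartzMoyal_apply θ f (schwartzMoyal θ g h)]
  let K (r p : Fin 4 → ℝ) : ℂ :=
    realPhase (r ⬝ᵥ x - (r - p) ⬝ᵥ θ.mulVec p) * f (x - θ.mulVec r) *
      (g.piFourier (r - p) * h.piFourier p)
  calc ∫ p, realPhase (p ⬝ᵥ x) * (schwartzMoyal θ f g (x - θ.mulVec p) * h.piFourier p)
      = ∫ p, ∫ r, K r p := by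
        refine integral_congr_ae (.of_forall fun p ↦ ?_)
        simp only
        rw [← integral_add_right_eq_self _ p, schwartzMoyal_apply, ← integral_mul_const,
          ← integral_const_mul]
        refine integral_congr_ae (.of_forall fun q ↦ ?_)
        simp only [K, add_sub_cancel_right]
        have hphase : realPhase ((q + p) ⬝ᵥ x - q ⬝ᵥ θ.mulVec p) =
            realPhase (p ⬝ᵥ x) * realPhase (q ⬝ᵥ (x - θ.mulVec p)) := by
          rw [← realPhase_add, add_dotProduct, dotProduct_sub]
          ring_nf
        have harg : x - θ.mulVec (q + p) = x - θ.mulVec p - θ.mulVec q := by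
          rw [Matrix.mulVec_add]
          abel
        rw [hphase, harg]
        ring
    _ = ∫ r, ∫ p, K r p :=
        (integral_integral_swap (integrable_moyalTriple θ f g.piFourier h.piFourier x)).symm
    _ = ∫ r, realPhase (r ⬝ᵥ x) * (f (x - θ.mulVec r) * (schwartzMoyal θ g h).piFourier r) := by
        refine integral_congr_ae (.of_forall fun r ↦ ?_)
        simp only [K]
        rw [piFourier_schwartzMoyal, ← integral_const_mul, ← integral_const_mul]
        refine integral_congr_ae (.of_forall fun p ↦ ?_)
        simp only [sub_eq_add_neg (r ⬝ᵥ x), realPhase_add]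
        ring

/-- For Schwartz functions on `ℝ⁴` and an invertible real
antisymmetric `4×4` matrix `θ`, the Moyal product of Schwartz functions is
again a Schwartz function, and the Moyal product is associative. -/
theorem stmt12 (θ : Matrix (Fin 4) (Fin 4) ℝ)
    (hθ_inv : θ.det ≠ 0) (hθ_anti : θ.transpose = -θ) :
    (∀ f h : SchwartzMap (Fin 4 → ℝ) ℂ,
      ∃ F : SchwartzMap (Fin 4 → ℝ) ℂ, ⇑F = moyal θ ⇑f ⇑h) ∧
    (∀ f g h : SchwartzMap (Fin 4 → ℝ) ℂ,
      moyal θ (moyal θ ⇑f ⇑g) ⇑h = moyal θ ⇑f (moyal θ ⇑g ⇑h)) := by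
  refine ⟨fun f h ↦ ⟨schwartzMoyal θ f h, coe_schwartzMoyal θ f h⟩, fun f g h ↦ ?_⟩
  simp only [← coe_schwartzMoyal, schwartzMoyal_assoc]
end

section
/- Left Moyal multiplication is non-local in time: there exist a, f ∈ 𝒮(ℝ⁴) with f supported in a set of the form {x : |x⁰| < ε} such that a ⋆ f is not supported in any slab {x : |x⁰| < T}; in fact there exist a, f with compactly supported f such that supp(a ⋆ f) is not compact. -/
open MeasureTheory

open Filter Topology Complex in
/-- An integral of a compactly supported continuous function against a kernel that depends
holomorphically on a parameter is an entire function of the parameter. -/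
theorem differentiable_integral_mul_of_hasCompactSupport {E : Type*} [TopologicalSpace E]
    [R1Space E] [MeasurableSpace E] [BorelSpace E] [SecondCountableTopology E] {μ : Measure E}
    [IsFiniteMeasureOnCompacts μ] {g : E → ℂ} (hg : Continuous g) (hgc : HasCompactSupport g)
    {K K' : ℂ → E → ℂ} (hK : ∀ s, Continuous (K s)) (hK' : Continuous fun q : ℂ × E => K' q.1 q.2)
    (hd : ∀ s w, HasDerivAt (fun s => K s w) (K' s w) s) :
    Differentiable ℂ fun s => ∫ w, K s w * g w ∂μ := by
  intro s₀
  obtain ⟨C, hC⟩ := ((isCompact_closedBall s₀ 1).prod hgc).exists_bound_of_continuousOn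
    hK'.continuousOn
  have hK'c : Continuous (K' s₀) := hK'.comp (Continuous.prodMk_right s₀)
  have key := hasDerivAt_integral_of_dominated_loc_of_deriv_le (μ := μ)
    (F := fun s w => K s w * g w) (F' := fun s w => K' s w * g w) (x₀ := s₀)
    (bound := fun w => C * ‖g w‖) (Metric.closedBall_mem_nhds s₀ one_pos)
    (Eventually.of_forall fun s => ((hK s).mul hg).aestronglyMeasurable)
    (((hK s₀).mul hg).integrable_of_hasCompactSupport hgc.mul_left)
    (hK'c.mul hg).aestronglyMeasurable
    (Eventually.of_forall fun w s hs => by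
      by_cases hw : w ∈ tsupport g
      · rw [norm_mul]
        exact mul_le_mul_of_nonneg_right (hC (s, w) ⟨hs, hw⟩) (norm_nonneg _)
      · simp [image_eq_zero_of_notMem_tsupport hw])
    ((hg.integrable_of_hasCompactSupport hgc).norm.const_mul C)
    (Eventually.of_forall fun w s _ => (hd s w).mul_const (g w))
  exact key.2.differentiableAt

open Filter Topology in
/-- An entire function that does not vanish at `0` does not vanish identically on any real
half-line. -/
theorem Differentiable.exists_ofReal_ge_ne_zero {H : ℂ → ℂ} (hH : Differentiable ℂ H)
    (h0 : H 0 ≠ 0) (T : ℝ) : ∃ s : ℝ, T ≤ s ∧ H s ≠ 0 := by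
  by_contra! hT
  have hfreq : ∃ᶠ z in 𝓝[≠] (T : ℂ), H z = 0 := by
    have ht : Tendsto (fun s : ℝ => (s : ℂ)) (𝓝[>] T) (𝓝[≠] (T : ℂ)) := by
      refine tendsto_nhdsWithin_iff.2
        ⟨Complex.continuous_ofReal.continuousAt.tendsto.mono_left nhdsWithin_le_nhds, ?_⟩
      filter_upwards [self_mem_nhdsWithin] with s hs
      simpa using (ne_of_gt hs)
    refine ht.frequently (Eventually.frequently ?_)
    filter_upwards [self_mem_nhdsWithin] with s hs
    exact hT s (le_of_lt hs)
  have hA : AnalyticOnNhd ℂ H Set.univ := fun z _ => hH.analyticAt z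
  exact h0 (hA.eqOn_zero_of_preconnected_of_frequently_eq_zero isPreconnected_univ
    (Set.mem_univ _) hfreq (Set.mem_univ 0))

/-- The Moyal product when the first factor is `b ∘ θ⁻¹`, as an integral over the product space. -/
theorem moyal_comp_inv_mulVec (θ : Matrix (Fin 4) (Fin 4) ℝ) (hθ : θ.det ≠ 0)
    {b f : (Fin 4 → ℝ) → ℂ} (hb : Continuous b) (hbc : HasCompactSupport b)
    (hf : Continuous f) (hfc : HasCompactSupport f) (x : Fin 4 → ℝ) :
    moyal θ (fun q => b (θ⁻¹.mulVec q)) f x =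
      ∫ w : (Fin 4 → ℝ) × (Fin 4 → ℝ),
        Complex.exp (2 * (Real.pi : ℂ) * Complex.I *
          ((∑ μ, (θ⁻¹.mulVec x μ - w.1 μ) * (x μ - w.2 μ) : ℝ) : ℂ)) * (b w.1 * f w.2) := by
  have hM : θ⁻¹ * θ = 1 := Matrix.nonsing_inv_mul _ (isUnit_iff_ne_zero.2 hθ)
  have hsub (p : Fin 4 → ℝ) : θ⁻¹.mulVec (x - θ.mulVec p) = θ⁻¹.mulVec x - p := by
    rw [Matrix.mulVec_sub, Matrix.mulVec_mulVec, hM, Matrix.one_mulVec]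
  have hint : Integrable (fun w : (Fin 4 → ℝ) × (Fin 4 → ℝ) =>
      Complex.exp (2 * (Real.pi : ℂ) * Complex.I *
        ((∑ μ, (θ⁻¹.mulVec x μ - w.1 μ) * (x μ - w.2 μ) : ℝ) : ℂ)) * (b w.1 * f w.2))
      (volume.prod volume) := by
    refine ((hb.integrable_of_hasCompactSupport hbc).mul_prod
      (hf.integrable_of_hasCompactSupport hfc)).bdd_mul (c := 1) ?_ ?_
    · exact Continuous.aestronglyMeasurable (by fun_prop)
    · refine Filter.Eventually.of_forall fun w => le_of_eq ?_
      rw [Complex.norm_exp]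
      simp
  rw [Measure.volume_eq_prod, integral_prod _ hint]
  unfold moyal
  rw [← integral_sub_left_eq_self _ volume (θ⁻¹.mulVec x)]
  refine integral_congr_ae (Filter.Eventually.of_forall fun r => ?_)
  dsimp only
  rw [← integral_sub_left_eq_self _ volume x]
  refine integral_congr_ae (Filter.Eventually.of_forall fun y => ?_)
  simp only [hsub, sub_sub_cancel, Pi.sub_apply, mul_assoc]

/-- If `φ` is nonnegative, continuous, supported in a small ball and nonzero at the origin, then
the Fourier-type double integral of `φ ⊗ φ` does not vanish. -/
theorem integral_exp_mul_ne_zero {φ : (Fin 4 → ℝ) → ℝ} (hφ : Continuous φ)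
    (hφs : tsupport φ ⊆ Metric.closedBall 0 (1 / 10)) (hφ0 : 0 ≤ φ) (hφ1 : φ 0 ≠ 0) :
    (∫ w : (Fin 4 → ℝ) × (Fin 4 → ℝ), Complex.exp (2 * (Real.pi : ℂ) * Complex.I *
      ((∑ μ, w.1 μ * w.2 μ : ℝ) : ℂ)) * ((φ w.1 : ℂ) * (φ w.2 : ℂ))) ≠ 0 := by
  have hc : HasCompactSupport φ :=
    (isCompact_closedBall _ _).of_isClosed_subset (isClosed_tsupport φ) hφs
  have hprod : HasCompactSupport fun w : (Fin 4 → ℝ) × (Fin 4 → ℝ) => φ w.1 * φ w.2 := by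
    refine HasCompactSupport.intro (hc.isCompact.prod hc.isCompact) fun w hw => ?_
    by_contra h
    exact hw ⟨subset_tsupport φ (left_ne_zero_of_mul h), subset_tsupport φ (right_ne_zero_of_mul h)⟩
  have hprodC : HasCompactSupport fun w : (Fin 4 → ℝ) × (Fin 4 → ℝ) => (φ w.1 : ℂ) * (φ w.2 : ℂ) := by
    have := hprod.comp_left (g := ((↑) : ℝ → ℂ)) Complex.ofReal_zero
    simpa [Function.comp_def] using this
  have hint : Integrable (fun w : (Fin 4 → ℝ) × (Fin 4 → ℝ) =>
      Complex.exp (2 * (Real.pi : ℂ) * Complex.I *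
        ((∑ μ, w.1 μ * w.2 μ : ℝ) : ℂ)) * ((φ w.1 : ℂ) * (φ w.2 : ℂ))) :=
    Continuous.integrable_of_hasCompactSupport (by fun_prop) hprodC.mul_left
  intro h0
  have hre := congrArg Complex.re h0
  have hre' := integral_re hint
  simp only [RCLike.re_eq_complex_re] at hre'
  rw [← hre', Complex.zero_re] at hre
  refine absurd hre (ne_of_gt ?_)
  have heq (w : (Fin 4 → ℝ) × (Fin 4 → ℝ)) :
      (Complex.exp (2 * (Real.pi : ℂ) * Complex.I *
        ((∑ μ, w.1 μ * w.2 μ : ℝ) : ℂ)) * ((φ w.1 : ℂ) * (φ w.2 : ℂ))).re =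
      Real.cos (2 * Real.pi * ∑ μ, w.1 μ * w.2 μ) * (φ w.1 * φ w.2) := by
    rw [← Complex.ofReal_mul, Complex.re_mul_ofReal, ← Complex.exp_ofReal_mul_I_re]
    congr 3
    push_cast
    ring
  simp only [heq]
  refine Continuous.integral_pos_of_hasCompactSupport_nonneg_nonzero (x := 0) (by fun_prop)
    hprod.mul_left ?_ (by simpa using hφ1)
  intro w
  by_cases hw : φ w.1 * φ w.2 = 0
  · simp [hw]
  refine mul_nonneg ?_ (mul_nonneg (hφ0 _) (hφ0 _))
  have h1 : ‖w.1‖ ≤ 1 / 10 := by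
    simpa using hφs (subset_tsupport φ (left_ne_zero_of_mul hw))
  have h2 : ‖w.2‖ ≤ 1 / 10 := by
    simpa using hφs (subset_tsupport φ (right_ne_zero_of_mul hw))
  have hsum : |∑ μ, w.1 μ * w.2 μ| ≤ 1 / 25 := by
    calc |∑ μ, w.1 μ * w.2 μ| ≤ ∑ μ, |w.1 μ * w.2 μ| := Finset.abs_sum_le_sum_abs _ _
      _ ≤ ∑ _μ : Fin 4, (1 / 10 : ℝ) * (1 / 10) := by
        refine Finset.sum_le_sum fun μ _ => ?_
        rw [abs_mul]
        exact mul_le_mul ((norm_le_pi_norm w.1 μ).trans h1) ((norm_le_pi_norm w.2 μ).trans h2)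
          (abs_nonneg _) (by norm_num)
      _ = 1 / 25 := by norm_num
  obtain ⟨hl, hu⟩ := abs_le.1 hsum
  refine Real.cos_nonneg_of_neg_pi_div_two_le_of_le ?_ ?_ <;> nlinarith [Real.pi_pos]

/-- There are compactly supported Schwartz functions `a` and `f`, with `f` supported in a thin time
slab, such that `a ⋆ f` is nonzero at points of arbitrarily large time coordinate. -/
theorem exists_moyal_ne_zero (θ : Matrix (Fin 4) (Fin 4) ℝ) (hθ : θ.det ≠ 0) :
    ∃ a f : SchwartzMap (Fin 4 → ℝ) ℂ, HasCompactSupport ⇑f ∧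
      tsupport ⇑f ⊆ {x : Fin 4 → ℝ | |x 0| < 1} ∧
      ∀ T : ℝ, ∃ x : Fin 4 → ℝ, T ≤ x 0 ∧ moyal θ ⇑a ⇑f x ≠ 0 := by
  let φ : ContDiffBump (0 : Fin 4 → ℝ) := ⟨1 / 20, 1 / 10, by norm_num, by norm_num⟩
  let b : (Fin 4 → ℝ) → ℂ := fun x => (φ x : ℂ)
  have hb : ContDiff ℝ (⊤ : ℕ∞) b := Complex.ofRealCLM.contDiff.comp φ.contDiff
  have hbc : HasCompactSupport b :=
    φ.hasCompactSupport.comp_left (g := ((↑) : ℝ → ℂ)) Complex.ofReal_zero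
  have hdet : IsUnit θ.det := isUnit_iff_ne_zero.2 hθ
  let a : (Fin 4 → ℝ) → ℂ := fun q => b (θ⁻¹.mulVec q)
  have ha : ContDiff ℝ (⊤ : ℕ∞) a :=
    hb.comp (LinearMap.toContinuousLinearMap (Matrix.mulVecLin θ⁻¹)).contDiff
  have hac : HasCompactSupport a := by
    refine HasCompactSupport.intro (K := θ.mulVec '' tsupport b)
      (hbc.isCompact.image (LinearMap.continuous_of_finiteDimensional (Matrix.mulVecLin θ)))
      fun q hq => ?_
    refine image_eq_zero_of_notMem_tsupport (f := b) fun h => hq ⟨_, h, ?_⟩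
    rw [Matrix.mulVec_mulVec, Matrix.mul_nonsing_inv _ hdet, Matrix.one_mulVec]
  refine ⟨hac.toSchwartzMap ha, hbc.toSchwartzMap hb, hbc, ?_, fun T => ?_⟩
  · intro x hx
    have hx' : x ∈ tsupport φ := by
      refine closure_mono (fun y (hy : b y ≠ 0) => ?_) hx
      exact fun h => hy (by simp [b, h])
    rw [φ.tsupport_eq, mem_closedBall_zero_iff] at hx'
    have : |x 0| ≤ 1 / 10 := (norm_le_pi_norm x 0).trans hx'
    exact this.trans_lt (by norm_num)
  let e : Fin 4 → ℝ := Pi.single 0 1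
  let m : Fin 4 → ℝ := θ⁻¹.mulVec e
  let Q : ℂ → (Fin 4 → ℝ) × (Fin 4 → ℝ) → ℂ := fun s w =>
    2 * (Real.pi : ℂ) * Complex.I * ∑ μ, (s * m μ - w.1 μ) * (s * e μ - w.2 μ)
  let Q' : ℂ → (Fin 4 → ℝ) × (Fin 4 → ℝ) → ℂ := fun s w =>
    2 * (Real.pi : ℂ) * Complex.I *
      ∑ μ, ((m μ : ℂ) * (s * e μ - w.2 μ) + (s * m μ - w.1 μ) * e μ)
  have hd (s : ℂ) (w : (Fin 4 → ℝ) × (Fin 4 → ℝ)) :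
      HasDerivAt (fun s => Complex.exp (Q s w)) (Complex.exp (Q s w) * Q' s w) s := by
    refine HasDerivAt.cexp (HasDerivAt.const_mul _ (HasDerivAt.fun_sum fun μ _ => ?_))
    have h1 : HasDerivAt (fun s : ℂ => s * (m μ : ℂ) - w.1 μ) (m μ) s := by
      simpa using ((hasDerivAt_id s).mul_const (m μ : ℂ)).sub_const (w.1 μ : ℂ)
    have h2 : HasDerivAt (fun s : ℂ => s * (e μ : ℂ) - w.2 μ) (e μ) s := by
      simpa using ((hasDerivAt_id s).mul_const (e μ : ℂ)).sub_const (w.2 μ : ℂ)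
    exact h1.mul h2
  have hprodC : HasCompactSupport fun w : (Fin 4 → ℝ) × (Fin 4 → ℝ) => b w.1 * b w.2 := by
    refine HasCompactSupport.intro (hbc.isCompact.prod hbc.isCompact) fun w hw => ?_
    by_contra h
    exact hw ⟨subset_tsupport b (left_ne_zero_of_mul h), subset_tsupport b (right_ne_zero_of_mul h)⟩
  have hbcont : Continuous b := hb.continuous
  have hH := differentiable_integral_mul_of_hasCompactSupport (μ := volume)
    (g := fun w : (Fin 4 → ℝ) × (Fin 4 → ℝ) => b w.1 * b w.2)
    (by fun_prop) hprodC (K := fun s w => Complex.exp (Q s w))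
    (K' := fun s w => Complex.exp (Q s w) * Q' s w) (fun s => by fun_prop) (by fun_prop) hd
  have h0 : (∫ w, Complex.exp (Q 0 w) * (b w.1 * b w.2)) ≠ 0 := by
    have := integral_exp_mul_ne_zero φ.continuous φ.tsupport_eq.subset (fun _ => φ.nonneg)
      (by rw [φ.one_of_mem_closedBall (by simp [φ.rIn_pos.le])]; exact one_ne_zero)
    simpa [Q, b] using this
  obtain ⟨s, hs, hne⟩ := hH.exists_ofReal_ge_ne_zero h0 T
  refine ⟨s • e, by simpa [e] using hs, ?_⟩
  have hmoyal := moyal_comp_inv_mulVec θ hθ hbcont hbc hbcont hbc (s • e)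
  change moyal θ a b (s • e) ≠ 0
  rw [hmoyal]
  convert hne using 5 with w
  simp [Q, m, Matrix.mulVec_smul]

/-- Left Moyal multiplication is non-local in time: there are
Schwartz functions `a, f` with `f` supported in a thin time slab
`{|x⁰| < ε}` such that `a ⋆ f` is supported in no time slab `{|x⁰| < T}`;
and there are `a, f` with `f` compactly supported such that `supp (a ⋆ f)`
is not compact. -/
theorem stmt14 (θ : Matrix (Fin 4) (Fin 4) ℝ)
    (hθ_inv : θ.det ≠ 0) (hθ_anti : θ.transpose = -θ) :
    (∃ (a f : SchwartzMap (Fin 4 → ℝ) ℂ) (ε : ℝ), 0 < ε ∧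
      tsupport ⇑f ⊆ {x : Fin 4 → ℝ | |x 0| < ε} ∧
      ∀ T : ℝ, ¬ (tsupport (moyal θ ⇑a ⇑f) ⊆ {x : Fin 4 → ℝ | |x 0| < T})) ∧
    (∃ a f : SchwartzMap (Fin 4 → ℝ) ℂ, HasCompactSupport ⇑f ∧
      ¬ IsCompact (tsupport (moyal θ ⇑a ⇑f))) := by
  obtain ⟨a, f, hfc, hfs, hne⟩ := exists_moyal_ne_zero θ hθ_inv
  have hslab (T : ℝ) : ¬ (tsupport (moyal θ ⇑a ⇑f) ⊆ {x : Fin 4 → ℝ | |x 0| < T}) := by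
    intro h
    obtain ⟨x, hx, hxne⟩ := hne T
    exact absurd (h (subset_tsupport _ hxne)) (not_lt.2 (hx.trans (le_abs_self _)))
  refine ⟨⟨a, f, 1, one_pos, hfs, hslab⟩, a, f, hfc, fun hcomp => ?_⟩
  obtain ⟨C, hC⟩ := hcomp.isBounded.exists_norm_le
  exact hslab (C + 1) fun x hx =>
    ((norm_le_pi_norm x 0).trans (hC x hx)).trans_lt (lt_add_one C)
end
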